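/- Square-field identity γ̂(m,1) = m^{A¹}: let k be a field with char k ≠ 2 and let m be a positive integer whose image in k is nonzero. Define the rank-m weight vector of γ̂(m,1) as follows: if m is odd, one entry m, (m−1)/2 entries 2m, and (m−1)/2 entries −2m; if m ≡ 0 (mod 4), m/4 entries 2m, m/4 entries −2m, m/4 entries 1, and m/4 entries −1; if m ≡ 2 (mod 4), one entry 1, one entry −1, (m−2)/4 entries 2m, (m−2)/4 entries −2m, (m−2)/4 entries 1, and (m−2)/4 entries −1. Then the diagonal quadratic form with these weights is equivalent to the diagonal form of m^{A¹}, namely: one entry m, (m−1)/2 entries 1, and (m−1)/2 entries −1 if m is odd; and m/2 entries 1 and m/2 entries −1 if m is even. -/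

import Mathlib

namespace QuadraticMap

/-- Reindexing a diagonal form along a bijection that matches the weights. -/
theorem weightedSumSquares_equivalent_of_equiv {R ι κ : Type*} [CommRing R]
    [Fintype ι] [Fintype κ] {w : ι → R} {w' : κ → R} (e : ι ≃ κ) (h : ∀ i, w' (e i) = w i) :
    (weightedSumSquares R w).Equivalent (weightedSumSquares R w') :=
  ⟨{ LinearEquiv.funCongrLeft R R e.symm with
      map_app' := fun x => by
        simp only [AddHom.toFun_eq_coe, LinearMap.coe_toAddHom, LinearEquiv.coe_coe,
          weightedSumSquares_apply]
        rw [← e.sum_comp]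
        simp [h, LinearEquiv.funCongrLeft, LinearMap.funLeft_apply] }⟩

/-- The diagonal form on a concatenation of weights is the orthogonal sum of the two pieces. -/
theorem weightedSumSquares_sumElim_equivalent_prod {R ι κ : Type*} [CommRing R]
    [Fintype ι] [Fintype κ] (u : ι → R) (v : κ → R) :
    (weightedSumSquares R (Sum.elim u v)).Equivalent
      ((weightedSumSquares R u).prod (weightedSumSquares R v)) :=
  ⟨{ LinearEquiv.sumArrowLequivProdArrow ι κ R R with
      map_app' := fun x => by
        simp [weightedSumSquares_apply, Fintype.sum_sum_type] }⟩

theorem weightedSumSquares_sumElim_congr {R ι κ ι' κ' : Type*} [CommRing R]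
    [Fintype ι] [Fintype κ] [Fintype ι'] [Fintype κ']
    {u : ι → R} {v : κ → R} {u' : ι' → R} {v' : κ' → R}
    (hu : (weightedSumSquares R u).Equivalent (weightedSumSquares R u'))
    (hv : (weightedSumSquares R v).Equivalent (weightedSumSquares R v')) :
    (weightedSumSquares R (Sum.elim u v)).Equivalent
      (weightedSumSquares R (Sum.elim u' v')) :=
  ((weightedSumSquares_sumElim_equivalent_prod u v).trans (hu.prod hv)).trans
    (weightedSumSquares_sumElim_equivalent_prod u' v').symm

/-- Over a field with `2 ≠ 0`, the form `n⟨a⟩ + n⟨-a⟩` is hyperbolic whenever `a ≠ 0`. -/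
theorem weightedSumSquares_sumElim_neg_equivalent {k ι : Type*} [Field k] [Fintype ι]
    (h2 : (2 : k) ≠ 0) {a : k} (ha : a ≠ 0) :
    (weightedSumSquares k (Sum.elim (fun _ : ι => a) (fun _ : ι => -a))).Equivalent
      (weightedSumSquares k (Sum.elim (fun _ : ι => (1 : k)) (fun _ : ι => -1))) :=
  ⟨{ toFun := fun x => Sum.elim
        (fun i => ((1 + a) * x (.inl i) + (1 - a) * x (.inr i)) / 2)
        (fun i => ((1 - a) * x (.inl i) + (1 + a) * x (.inr i)) / 2)
     invFun := fun x => Sum.elim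
        (fun i => ((1 + a⁻¹) * x (.inl i) + (1 - a⁻¹) * x (.inr i)) / 2)
        (fun i => ((1 - a⁻¹) * x (.inl i) + (1 + a⁻¹) * x (.inr i)) / 2)
     map_add' := fun x y => by
        ext (i | i) <;> simp only [Sum.elim_inl, Sum.elim_inr, Pi.add_apply] <;> ring
     map_smul' := fun c x => by
        ext (i | i) <;>
          simp only [Sum.elim_inl, Sum.elim_inr, Pi.smul_apply, smul_eq_mul, RingHom.id_apply] <;>
          ring
     left_inv := fun x => by
        ext (i | i) <;> simp only [Sum.elim_inl, Sum.elim_inr] <;> field_simp <;> ring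
     right_inv := fun x => by
        ext (i | i) <;> simp only [Sum.elim_inl, Sum.elim_inr] <;> field_simp <;> ring
     map_app' := fun x => by
        simp only [weightedSumSquares_apply, Fintype.sum_sum_type, Sum.elim_inl, Sum.elim_inr,
          smul_eq_mul, ← Finset.sum_add_distrib]
        refine Finset.sum_congr rfl fun i _ => ?_
        field_simp
        ring }⟩

/-- Two hyperbolic blocks, the first one scaled by `a ≠ 0`. -/
theorem weightedSumSquares_sumElim_neg_sumElim_equivalent {k ι κ : Type*} [Field k]
    [Fintype ι] [Fintype κ] (h2 : (2 : k) ≠ 0) {a : k} (ha : a ≠ 0) :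
    (weightedSumSquares k (Sum.elim (fun _ : ι => a) (Sum.elim (fun _ : ι => -a)
      (Sum.elim (fun _ : κ => (1 : k)) (fun _ : κ => -1))))).Equivalent
      (weightedSumSquares k (Sum.elim (fun _ : ι ⊕ κ => (1 : k)) (fun _ : ι ⊕ κ => -1))) := by
  refine (weightedSumSquares_equivalent_of_equiv
    (w' := Sum.elim (Sum.elim (fun _ : ι => a) (fun _ : ι => -a))
      (Sum.elim (fun _ : κ => (1 : k)) (fun _ : κ => -1)))
    (Equiv.sumAssoc _ _ _).symm ?_).trans
    ((weightedSumSquares_sumElim_congr (weightedSumSquares_sumElim_neg_equivalent h2 ha)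
      (.refl _)).trans (weightedSumSquares_equivalent_of_equiv (Equiv.sumSumSumComm _ _ _ _) ?_))
  · rintro (i | i | i | i) <;> rfl
  · rintro ((i | i) | (i | i)) <;> rfl

end QuadraticMap


/-- Square-field identity `γ̂(m,1) = m^{A¹}`.  For `m` positive with
`(m : k) ≠ 0`, the rank-`m` diagonal form of `γ̂(m,1)` (in the three cases `m` odd,
`m ≡ 0 (mod 4)`, `m ≡ 2 (mod 4)`) is equivalent to the diagonal form of `m^{A¹}`. -/
theorem stmt11 (k : Type) [Field k] (hk : ringChar k ≠ 2)
    (m : ℕ) (hm : 0 < m) (hmk : (m : k) ≠ 0) :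
    (∀ c : ℕ, m = 2 * c + 1 →
      (QuadraticMap.weightedSumSquares k
          (Sum.elim (fun _ : Fin 1 => (m : k))
            (Sum.elim (fun _ : Fin c => 2 * (m : k))
              (fun _ : Fin c => -(2 * (m : k)))))).Equivalent
        (QuadraticMap.weightedSumSquares k
          (Sum.elim (fun _ : Fin 1 => (m : k))
            (Sum.elim (fun _ : Fin c => (1 : k)) (fun _ : Fin c => (-1 : k)))))) ∧
    (∀ q : ℕ, m = 4 * q →
      (QuadraticMap.weightedSumSquares k
          (Sum.elim (fun _ : Fin q => 2 * (m : k))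
            (Sum.elim (fun _ : Fin q => -(2 * (m : k)))
              (Sum.elim (fun _ : Fin q => (1 : k)) (fun _ : Fin q => (-1 : k)))))).Equivalent
        (QuadraticMap.weightedSumSquares k
          (Sum.elim (fun _ : Fin (m / 2) => (1 : k))
            (fun _ : Fin (m / 2) => (-1 : k))))) ∧
    (∀ q : ℕ, m = 4 * q + 2 →
      (QuadraticMap.weightedSumSquares k
          (Sum.elim (fun _ : Fin 1 => (1 : k))
            (Sum.elim (fun _ : Fin 1 => (-1 : k))
              (Sum.elim (fun _ : Fin q => 2 * (m : k))
                (Sum.elim (fun _ : Fin q => -(2 * (m : k)))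
                  (Sum.elim (fun _ : Fin q => (1 : k))
                    (fun _ : Fin q => (-1 : k)))))))).Equivalent
        (QuadraticMap.weightedSumSquares k
          (Sum.elim (fun _ : Fin (m / 2) => (1 : k))
            (fun _ : Fin (m / 2) => (-1 : k))))) := by
  have h2 : (2 : k) ≠ 0 := Ring.two_ne_zero hk
  have h2m : 2 * (m : k) ≠ 0 := mul_ne_zero h2 hmk
  refine ⟨fun c _ => ?_, fun q hq => ?_, fun q hq => ?_⟩
  · exact QuadraticMap.weightedSumSquares_sumElim_congr (.refl _)
      (QuadraticMap.weightedSumSquares_sumElim_neg_equivalent h2 h2m)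
  · let e : Fin q ⊕ Fin q ≃ Fin (m / 2) := finSumFinEquiv.trans (finCongr (by omega))
    refine (QuadraticMap.weightedSumSquares_sumElim_neg_sumElim_equivalent h2 h2m).trans
      (QuadraticMap.weightedSumSquares_equivalent_of_equiv (Equiv.sumCongr e e) ?_)
    rintro (i | i) <;> rfl
  · let e : Fin 1 ⊕ (Fin q ⊕ Fin q) ≃ Fin (m / 2) :=
      ((Equiv.sumCongr (.refl _) finSumFinEquiv).trans finSumFinEquiv).trans
        (finCongr (by omega))
    refine (QuadraticMap.weightedSumSquares_sumElim_congr (.refl _)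
      (QuadraticMap.weightedSumSquares_sumElim_congr (.refl _)
        (QuadraticMap.weightedSumSquares_sumElim_neg_sumElim_equivalent h2 h2m))).trans
      (QuadraticMap.weightedSumSquares_equivalent_of_equiv
        (((Equiv.sumAssoc _ _ _).symm.trans (Equiv.sumSumSumComm _ _ _ _)).trans
          (Equiv.sumCongr e e)) ?_)
    rintro (i | i | i | i) <;> rfl
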